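/- Let μ be an acyclic partial matching on a finite graded poset P and let γ, δ be composable flow paths (ι(δ) < τ(γ)). Then the reductions r(γ) and r(δ) are composable, and r(γ * δ) = r(r(γ) * r(δ)). -/

import Mathlib

/-- A partial matching on a poset `P`: a bijection `μ : D → U` between disjoint
subsets `D, U ⊆ P` such that `d ⋖ μ d` for every `d ∈ D`. -/
structure PartialMatching (P : Type) [PartialOrder P] where
  D : Set P
  U : Set P
  m : P → P
  minv : P → P
  disj : Disjoint D U
  m_mem : ∀ d ∈ D, m d ∈ U
  minv_mem : ∀ u ∈ U, minv u ∈ D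
  left_inv : ∀ d ∈ D, minv (m d) = d
  right_inv : ∀ u ∈ U, m (minv u) = u
  cov : ∀ d ∈ D, d ⋖ m d

namespace PartialMatching

variable {P : Type} [PartialOrder P]

/-- The set of critical elements. -/
def Cr (M : PartialMatching P) : Set P := (M.D ∪ M.U)ᶜ

/-- A partial matching is acyclic if every Forman path is a gradient path. -/
def IsAcyclic (M : PartialMatching P) : Prop :=
  ∀ (n : ℕ) (d : ℕ → P), 1 ≤ n →
    (∀ i j, i < n → j < n → d i = d j → i = j) →
    (∀ i, i < n → d i ∈ M.D) →
    (∀ i, i + 1 < n → d (i + 1) ⋖ M.m (d i)) →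
    n = 1 ∨ ¬ d 0 ⋖ M.m (d (n - 1))

/-- A faithful discrete Morse function adapted to `M`. -/
def Faithful (M : PartialMatching P) (f : P → ℤ) : Prop :=
  Function.Injective f ∧
  (∀ d ∈ M.D, f (M.m d) < f d) ∧
  ∀ e e' : P, e < e' → ¬(e ∈ M.D ∧ e' = M.m e) → f e < f e'

end PartialMatching

/-- The data of a flow path `(e₁,u₁,…,e_n,u_n;c)`: the list of pairs
`steps = [(e₁,u₁),…,(e_n,u_n)]` and the final (critical) cell `c`. -/
structure FlowPath (P : Type) where
  steps : List (P × P)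
  c : P

namespace FlowPath

variable {P : Type} [PartialOrder P]

/-- The length `ℓ(γ) = n` of a flow path. -/
def len (γ : FlowPath P) : ℕ := γ.steps.length

/-- `eAt γ i = e_{i+1}` (0-based); by convention `eAt γ i = c` for `i ≥ len γ`. -/
def eAt (γ : FlowPath P) (i : ℕ) : P := (γ.steps.map Prod.fst).getD i γ.c

/-- `uAt γ i = u_{i+1}` (0-based). -/
def uAt (γ : FlowPath P) (i : ℕ) : P := (γ.steps.map Prod.snd).getD i γ.c

/-- The initial cell `ι(γ)` (equal to `c` when `len γ = 0`). -/
def init (γ : FlowPath P) : P := γ.eAt 0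

/-- The target `τ(γ) = c`. -/
def tgt (γ : FlowPath P) : P := γ.c

/-- `γ` is a genuine flow path with respect to the matching `M`. -/
def Valid (M : PartialMatching P) (γ : FlowPath P) : Prop :=
  γ.c ∈ M.Cr ∧
  ∀ i, i < γ.len →
    γ.uAt i ∈ M.U ∧
    (γ.eAt i = γ.uAt i ∨ γ.eAt i = M.minv (γ.uAt i)) ∧
    γ.eAt (i + 1) < γ.uAt i ∧
    γ.eAt (i + 1) ≠ M.minv (γ.uAt i)

/-- `φ : {0,…,k} → {0,…,ℓ(γ')+1}` is an embedding function for `γ ⪯ γ'`.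
Indices of cells are 1-based as in the paper, so the paper's `e_j` is `eAt γ (j-1)`. -/
def IsEmbed (γ γ' : FlowPath P) (k : ℕ) (φ : ℕ → ℕ) : Prop :=
  1 ≤ k ∧ k ≤ γ.len + 1 ∧
  (∀ i j, i < j → j ≤ k → φ i < φ j) ∧
  φ 0 = 0 ∧ φ k = γ'.len + 1 ∧
  (∀ j, 1 ≤ j → j < k → γ.uAt (j - 1) = γ'.uAt (φ j - 1)) ∧
  (∀ j p, 1 ≤ j → j ≤ k → φ (j - 1) < p → p ≤ φ j → γ.eAt (j - 1) ≤ γ'.eAt (p - 1))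

/-- The subpath relation `γ ⪯ γ'`. -/
def Subpath (γ γ' : FlowPath P) : Prop := ∃ k φ, IsEmbed γ γ' k φ

/-- `γ` is reducible at `i` (0-based; the paper's index is `i+1`). -/
def ReducibleAt (M : PartialMatching P) (γ : FlowPath P) (i : ℕ) : Prop :=
  i < γ.len ∧ γ.eAt (i + 1) < M.minv (γ.uAt i)

/-- `γ` is reduced: it is reducible at no index. -/
def Reduced (M : PartialMatching P) (γ : FlowPath P) : Prop :=
  ∀ i, ¬ ReducibleAt M γ i

/-- Concatenation `γ * δ` of flow paths. -/
def concat (γ δ : FlowPath P) : FlowPath P := ⟨γ.steps ++ δ.steps, δ.c⟩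

/-- The collapse `τ(γ ⪯ γ')`: the tail of `γ` starting at its (1-based) `k`-th cell. -/
def collapse (γ : FlowPath P) (k : ℕ) : FlowPath P := ⟨γ.steps.drop (k - 1), γ.c⟩

/-- `rγ` is the reduction of `γ`: the greatest reduced flow path `⪯ γ`. -/
def IsReduction (M : PartialMatching P) (γ rγ : FlowPath P) : Prop :=
  Valid M rγ ∧ Reduced M rγ ∧ Subpath rγ γ ∧
  ∀ δ, Valid M δ → Reduced M δ → Subpath δ γ → Subpath δ rγ

end FlowPath

namespace FlowPath

section Cells

variable {P : Type}

/-- The initial cell of the flow path with steps `l` and target `c`. -/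
def headCell (c : P) : List (P × P) → P
  | [] => c
  | s :: _ => s.1

@[simp] lemma eAt_cons_succ (s : P × P) (l : List (P × P)) (c : P) (i : ℕ) :
    eAt ⟨s :: l, c⟩ (i + 1) = eAt ⟨l, c⟩ i := by simp [eAt]

@[simp] lemma uAt_cons_succ (s : P × P) (l : List (P × P)) (c : P) (i : ℕ) :
    uAt ⟨s :: l, c⟩ (i + 1) = uAt ⟨l, c⟩ i := by simp [uAt]

@[simp] lemma uAt_cons_zero (s : P × P) (l : List (P × P)) (c : P) :
    uAt ⟨s :: l, c⟩ 0 = s.2 := by simp [uAt]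

@[simp] lemma eAt_zero (l : List (P × P)) (c : P) : eAt ⟨l, c⟩ 0 = headCell c l := by
  cases l <;> simp [eAt, headCell]

@[simp] lemma len_cons (s : P × P) (l : List (P × P)) (c : P) :
    len ⟨s :: l, c⟩ = len ⟨l, c⟩ + 1 := rfl

end Cells

variable {P : Type} [PartialOrder P]

/-- The step conditions for a flow path, by recursion on its steps. -/
def StepsValid (M : PartialMatching P) (c : P) : List (P × P) → Prop
  | [] => True
  | s :: l => s.2 ∈ M.U ∧ (s.1 = s.2 ∨ s.1 = M.minv s.2) ∧ headCell c l < s.2 ∧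
      headCell c l ≠ M.minv s.2 ∧ StepsValid M c l

/-- Reducedness of a flow path, by recursion on its steps. -/
def StepsReduced (M : PartialMatching P) (c : P) : List (P × P) → Prop
  | [] => True
  | s :: l => ¬ headCell c l < M.minv s.2 ∧ StepsReduced M c l

/-- The subpath relation between flow paths with targets `c` and `c'`, described by scanning the
steps of the larger path. -/
inductive Emb (c c' : P) : List (P × P) → List (P × P) → Prop
  | nil {l} (h : headCell c l ≤ c') : Emb c c' l []
  | skip {l e u l'} (h : headCell c l ≤ e) (hl : Emb c c' l l') : Emb c c' l ((e, u) :: l')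
  | keep {e e' u l l'} (h : e ≤ e') (hl : Emb c c' l l') : Emb c c' ((e, u) :: l) ((e', u) :: l')

/-- Embeddings of flow paths with common target `c` that use all steps of the smaller path. -/
inductive FullEmb (c : P) : List (P × P) → List (P × P) → Prop
  | nil : FullEmb c [] []
  | skip {l e u l'} (h : headCell c l ≤ e) (hl : FullEmb c l l') : FullEmb c l ((e, u) :: l')
  | keep {e e' u l l'} (h : e ≤ e') (hl : FullEmb c l l') :
      FullEmb c ((e, u) :: l) ((e', u) :: l')

lemma valid_iff (M : PartialMatching P) (l : List (P × P)) (c : P) :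
    Valid M ⟨l, c⟩ ↔ c ∈ M.Cr ∧ StepsValid M c l := by
  refine and_congr_right fun hc => ?_
  clear hc
  induction l with
  | nil => simp [StepsValid, len]
  | cons s l ih =>
    rw [StepsValid, ← ih]
    constructor
    · intro h
      have h0 := h 0 (by simp)
      simp only [eAt_zero, uAt_cons_zero, eAt_cons_succ, headCell] at h0
      exact ⟨h0.1, h0.2.1, h0.2.2.1, h0.2.2.2, fun i hi => by simpa using h (i + 1) (by simpa)⟩
    · rintro ⟨h1, h2, h3, h4, h⟩ (_ | i) hi
      · simpa [headCell] using ⟨h1, h2, h3, h4⟩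
      · simpa using h i (by simpa using hi)

lemma reduced_iff (M : PartialMatching P) (l : List (P × P)) (c : P) :
    Reduced M ⟨l, c⟩ ↔ StepsReduced M c l := by
  induction l with
  | nil => simp [StepsReduced, Reduced, ReducibleAt, len]
  | cons s l ih =>
    rw [StepsReduced, ← ih]
    constructor
    · intro h
      exact ⟨by simpa [ReducibleAt] using h 0, fun i => by simpa [ReducibleAt] using h (i + 1)⟩
    · rintro ⟨h0, h⟩ (_ | i)
      · simpa [ReducibleAt] using h0
      · simpa [ReducibleAt] using h i

lemma Emb.subpath {c c' : P} {l l' : List (P × P)} (h : Emb c c' l l') :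
    Subpath ⟨l, c⟩ ⟨l', c'⟩ := by
  induction h with
  | @nil l h =>
    refine ⟨1, id, le_rfl, by omega, fun i j hij _ => hij, rfl, rfl, by omega, ?_⟩
    intro j p hj hj' hp hp'
    obtain rfl : j = 1 := by omega
    obtain rfl : p = 1 := by simp at hp hp'; omega
    simpa [headCell] using h
  | @skip l e u l' h hl ih =>
    obtain ⟨k, φ, hk, hk', hmono, h0, hlast, hu, he⟩ := ih
    have hpos : ∀ j, 1 ≤ j → j ≤ k → 1 ≤ φ j := fun j h1 h2 => by
      have := hmono 0 j (by omega) h2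
      omega
    refine ⟨k, fun j => if j = 0 then 0 else φ j + 1, hk, hk', ?_, by simp, ?_, ?_, ?_⟩
    · intro i j hij hj
      have := hmono i j hij hj
      dsimp only
      split_ifs <;> omega
    · simp [show k ≠ 0 by omega, hlast]
    · intro j hj hjk
      have := hpos j hj hjk.le
      dsimp only
      rw [hu j hj hjk, if_neg (by omega), show φ j + 1 - 1 = (φ j - 1) + 1 by omega, uAt_cons_succ]
    · intro j p hj hjk hp hp'
      dsimp only at hp hp'
      rw [if_neg (by omega)] at hp'
      obtain rfl | hp1 := eq_or_ne p 1
      · obtain rfl : j = 1 := by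
          by_contra hne
          rw [if_neg (by omega)] at hp
          omega
        simpa [headCell] using h
      · have hp0 : p ≠ 0 := by omega
        have := he j (p - 1) hj hjk (by split_ifs at hp with hj1
                                        · rw [hj1, h0]; omega
                                        · omega) (by omega)
        rwa [show p - 1 = (p - 1 - 1) + 1 by omega, eAt_cons_succ]
  | @keep e e' u l l' h hl ih =>
    obtain ⟨k, φ, hk, hk', hmono, h0, hlast, hu, he⟩ := ih
    refine ⟨k + 1, fun j => if j = 0 then 0 else φ (j - 1) + 1, by omega, by simpa using hk', ?_,
      by simp, by simp [hlast], ?_, ?_⟩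
    · intro i j hij hj
      dsimp only
      rw [if_neg (by omega : j ≠ 0)]
      split_ifs with hi
      · omega
      · have := hmono (i - 1) (j - 1) (by omega) (by omega)
        omega
    · rintro (_ | _ | j) hj hjk
      · omega
      · simp [h0]
      · have := hmono 0 (j + 1) (by omega) (by omega)
        have h2 := hu (j + 1) (by omega) (by omega)
        simp only [Nat.add_sub_cancel] at h2
        simp only [Nat.add_sub_cancel, uAt_cons_succ, h2, Nat.add_eq_zero_iff, one_ne_zero,
          and_false, if_false]
        rw [← uAt_cons_succ (e', u), Nat.sub_add_cancel (by omega)]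
    · rintro (_ | _ | j) p hj hjk hp hp'
      · omega
      · simp [h0] at hp hp'
        obtain rfl : p = 1 := by omega
        simpa [headCell] using h
      · simp at hp hp'
        have h2 := he (j + 1) (p - 1) (by omega) (by omega) (by simp; omega) (by omega)
        rw [show p - 1 = (p - 1 - 1) + 1 by omega]
        simpa using h2

lemma Subpath.emb {c c' : P} {l l' : List (P × P)} (h : Subpath ⟨l, c⟩ ⟨l', c'⟩) :
    Emb c c' l l' := by
  obtain ⟨k, φ, h⟩ := h
  induction l' generalizing l k φ with
  | nil =>
    obtain ⟨hk, hk', hmono, h0, hlast, hu, he⟩ := h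
    have := hmono 0 1 (by omega) hk
    exact .nil (by simpa [headCell] using he 1 1 le_rfl hk (by simp [h0]) (by omega))
  | cons s l' ih =>
    obtain ⟨e', u'⟩ := s
    obtain ⟨hk, hk', hmono, h0, hlast, hu, he⟩ := h
    have h1 := hmono 0 1 (by omega) hk
    have hinit : headCell c l ≤ e' := by
      simpa [headCell] using he 1 1 le_rfl hk (by simp [h0]) (by omega)
    rw [len_cons] at hlast
    by_cases hφ : φ 1 = 1
    · have hk2 : 2 ≤ k := by
        by_contra hk2
        obtain rfl : k = 1 := by omega
        omega
      have hpos : ∀ j, 1 ≤ j → j ≤ k → 1 ≤ φ j := fun j h1 h2 => by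
        have := hmono 0 j (by omega) h2
        omega
      cases l with
      | nil => simp [len] at hk'; omega
      | cons s l =>
        obtain ⟨e, u⟩ := s
        have huu : u = u' := by simpa [hφ] using hu 1 le_rfl (by omega)
        subst huu
        refine .keep hinit (ih (k - 1) (fun j => φ (j + 1) - 1) ⟨by omega, ?_, ?_, by simp [hφ], ?_,
          ?_, ?_⟩)
        · rw [len_cons] at hk'; omega
        · intro i j hij hj
          have := hmono (i + 1) (j + 1) (by omega) (by omega)
          have := hpos (i + 1) (by omega) (by omega)
          dsimp only
          omega
        · simp [Nat.sub_add_cancel hk, hlast]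
        · intro j hj hjk
          have h2 := hu (j + 1) (by omega) (by omega)
          have h3 := hmono 1 (j + 1) (by omega) (by omega)
          rw [show j + 1 - 1 = (j - 1) + 1 by omega, uAt_cons_succ,
            show φ (j + 1) - 1 = (φ (j + 1) - 1 - 1) + 1 by omega, uAt_cons_succ] at h2
          exact h2
        · intro j p hj hjk hp hp'
          dsimp only at hp hp'
          have h3 := hpos (j + 1) (by omega) (by omega)
          have h2 := he (j + 1) (p + 1) (by omega) (by omega)
            (by rw [Nat.sub_add_cancel hj] at hp; rw [Nat.add_sub_cancel]; omega) (by omega)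
          rwa [show j + 1 - 1 = (j - 1) + 1 by omega, eAt_cons_succ,
            show p + 1 - 1 = (p - 1) + 1 by omega, eAt_cons_succ] at h2
    · have hpos : ∀ j, 1 ≤ j → j ≤ k → 2 ≤ φ j := fun j h1 h2 => by
        obtain rfl | hj := eq_or_ne j 1
        · omega
        · have := hmono 1 j (by omega) h2
          omega
      refine .skip hinit (ih k (fun j => φ j - 1) ⟨hk, hk', ?_, by simp [h0], by simp [hlast],
        ?_, ?_⟩)
      · intro i j hij hj
        have := hmono i j hij hj
        have := hpos j (by omega) hj
        dsimp only
        omega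
      · intro j hj hjk
        have := hpos j hj hjk.le
        have h2 := hu j hj hjk
        rwa [show φ j - 1 = (φ j - 1 - 1) + 1 by omega, uAt_cons_succ] at h2
      · intro j p hj hjk hp hp'
        dsimp only at hp hp'
        have := hpos j hj hjk
        have h2 := he j (p + 1) hj hjk (by omega) (by omega)
        rwa [show p + 1 - 1 = (p - 1) + 1 by omega, eAt_cons_succ] at h2

lemma subpath_iff {c c' : P} {l l' : List (P × P)} :
    Subpath ⟨l, c⟩ ⟨l', c'⟩ ↔ Emb c c' l l' := ⟨Subpath.emb, Emb.subpath⟩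

lemma Emb.headCell_le {c c' : P} {l l' : List (P × P)} (h : Emb c c' l l') :
    headCell c l ≤ headCell c' l' := by
  cases h <;> assumption

lemma FullEmb.headCell_le {c : P} {l l' : List (P × P)} (h : FullEmb c l l') :
    headCell c l ≤ headCell c l' := by
  cases h
  · exact le_rfl
  all_goals assumption

lemma FullEmb.emb {c : P} {l l' : List (P × P)} (h : FullEmb c l l') : Emb c c l l' := by
  induction h with
  | nil => exact .nil le_rfl
  | skip h _ ih => exact .skip h ih
  | keep h _ ih => exact .keep h ih

lemma Emb.refl (c : P) (l : List (P × P)) : Emb c c l l := by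
  induction l with
  | nil => exact .nil le_rfl
  | cons s l ih => exact .keep le_rfl ih

lemma Emb.trans {a b c : P} {l₁ l₂ l₃ : List (P × P)} (h₁ : Emb a b l₁ l₂) (h₂ : Emb b c l₂ l₃) :
    Emb a c l₁ l₃ := by
  induction h₂ generalizing l₁ with
  | nil h => exact .nil (h₁.headCell_le.trans h)
  | skip h _ ih => exact .skip (h₁.headCell_le.trans h) (ih h₁)
  | keep h _ ih =>
    cases h₁ with
    | skip h' h₁ => exact .skip (h'.trans h) (ih h₁)
    | keep h' h₁ => exact .keep (h'.trans h) (ih h₁)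

lemma FullEmb.length_le {c : P} {l l' : List (P × P)} (h : FullEmb c l l') :
    l.length ≤ l'.length := by
  induction h <;> simp <;> omega

lemma FullEmb.antisymm {c : P} {l l' : List (P × P)} (h : FullEmb c l l') (h' : FullEmb c l' l) :
    l = l' := by
  induction h with
  | nil => rfl
  | skip h hl ih =>
    have := hl.length_le
    have := h'.length_le
    simp at this
    omega
  | keep h hl ih =>
    cases h' with
    | skip _ h'' =>
      have := hl.length_le
      have := h''.length_le
      simp at this
      omega
    | keep h1 h2 => rw [ih h2, le_antisymm h h1]

lemma headCell_append_le {c d : P} {l l' : List (P × P)} (h : headCell d l' ≤ c) :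
    headCell d (l ++ l') ≤ headCell c l := by
  cases l
  · exact h
  · exact le_rfl

lemma FullEmb.append {c d d' : P} {l₁ l₁' l₂ l₂' : List (P × P)} (h₁ : FullEmb c l₁ l₁')
    (h₂ : Emb d d' l₂ l₂') (h : headCell d l₂ ≤ c) : Emb d d' (l₁ ++ l₂) (l₁' ++ l₂') := by
  induction h₁ with
  | nil => exact h₂
  | skip h' _ ih => exact .skip ((headCell_append_le h).trans h') ih
  | keep h' _ ih => exact .keep h' ih

section Rank

variable {rk : P → ℕ} {M : PartialMatching P}

lemma minv_covBy {u : P} (hu : u ∈ M.U) : M.minv u ⋖ u := by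
  simpa [M.right_inv u hu] using M.cov _ (M.minv_mem u hu)

lemma strictMono_of_covBy [Finite P] (hrk : ∀ a b : P, a ⋖ b → rk b = rk a + 1) :
    StrictMono rk := by
  have := Fintype.ofFinite P
  classical
  have := Fintype.toLocallyFiniteOrder (α := P)
  exact strictMono_iff_forall_covBy rk |>.2 fun a b h => by rw [hrk a b h]; omega

lemma StepsValid.rank_le (hmono : StrictMono rk) (hrk : ∀ a b : P, a ⋖ b → rk b = rk a + 1)
    {c : P} {l : List (P × P)} (hl : StepsValid M c l) : rk c ≤ rk (headCell c l) := by
  induction l with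
  | nil => exact le_rfl
  | cons s l ih =>
    obtain ⟨hu, he, hlt, -, hl⟩ := hl
    have h1 := ih hl
    have h2 := hmono hlt
    have h3 := hrk _ _ (minv_covBy hu)
    rcases he with he | he <;> simp only [headCell, he] <;> omega

lemma Emb.rank_le (hmono : StrictMono rk) (hrk : ∀ a b : P, a ⋖ b → rk b = rk a + 1)
    {c c' : P} {l l' : List (P × P)} (h : Emb c c' l l') (hl : StepsValid M c l) :
    rk c ≤ rk c' := by
  induction h with
  | nil h => exact (hl.rank_le hmono hrk).trans (hmono.monotone h)
  | skip _ _ ih => exact ih hl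
  | keep _ _ ih => exact ih hl.2.2.2.2

/-- An embedding into a path whose target has no larger rank preserves the target and is full. -/
lemma Emb.full (hmono : StrictMono rk) (hrk : ∀ a b : P, a ⋖ b → rk b = rk a + 1)
    {c c' : P} {l l' : List (P × P)} (h : Emb c c' l l') (hl : StepsValid M c l)
    (hc' : c' ∈ M.Cr) (hle : rk c' ≤ rk c) : c = c' ∧ FullEmb c l l' := by
  induction h with
  | @nil l h =>
    have heq : headCell c l = c' := by
      refine h.eq_or_lt.resolve_right fun hlt => ?_
      have := hmono hlt
      have := hl.rank_le hmono hrk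
      omega
    cases l with
    | nil => exact ⟨heq, .nil⟩
    | cons s l =>
      refine absurd ?_ hc'
      obtain ⟨hu, he | he, -⟩ := hl
      · exact Or.inr (by rwa [← heq, headCell, he])
      · exact Or.inl (by rw [← heq, headCell, he]; exact M.minv_mem _ hu)
  | skip h _ ih => exact ⟨(ih hl).1, .skip h (ih hl).2⟩
  | keep h _ ih => exact ⟨(ih hl.2.2.2.2).1, .keep h (ih hl.2.2.2.2).2⟩

lemma Subpath.antisymm (hmono : StrictMono rk) (hrk : ∀ a b : P, a ⋖ b → rk b = rk a + 1)
    {γ γ' : FlowPath P} (hγ : Valid M γ) (hγ' : Valid M γ') (h : Subpath γ γ')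
    (h' : Subpath γ' γ) : γ = γ' := by
  obtain ⟨l, c⟩ := γ
  obtain ⟨l', c'⟩ := γ'
  rw [valid_iff] at hγ hγ'
  rw [subpath_iff] at h h'
  obtain ⟨rfl, hf⟩ := h.full hmono hrk hγ.2 hγ'.1 (h'.rank_le hmono hrk hγ'.2)
  rw [hf.antisymm (h'.full hmono hrk hγ'.2 hγ.1 le_rfl).2]

end Rank

section Reduction

variable {M : PartialMatching P}

lemma StepsValid.cons_of_le {c e u : P} {l l' : List (P × P)}
    (hu : u ∈ M.U) (he : e = u ∨ e = M.minv u) (hlt : headCell c l < u)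
    (hne : headCell c l ≠ M.minv u) (hle : headCell c l' ≤ headCell c l)
    (hl' : StepsValid M c l') : StepsValid M c ((e, u) :: l') :=
  ⟨hu, he, hle.trans_lt hlt, fun heq =>
    (minv_covBy hu).2 (lt_of_le_of_ne (heq ▸ hle) hne.symm) hlt, hl'⟩

/-- Any embedding of a reduced path `s` into a concatenation `g ++ d` factors through `t ++ d'`,
where `t` is a reduced path embedded in `g` with the same target, and `d'` dominates all reduced
paths below `d`. -/
lemma exists_reduced_append {c a b b' : P} {s g d d' : List (P × P)}
    (hd' : headCell b' d' ≤ c) (hg : StepsValid M c g)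
    (hmax : ∀ t, StepsValid M a t → StepsReduced M a t → Emb a b t d → Emb a b' t d')
    (hs : StepsValid M a s) (hsr : StepsReduced M a s) (h : Emb a b s (g ++ d)) :
    ∃ t, StepsValid M c t ∧ StepsReduced M c t ∧ FullEmb c t g ∧ Emb a b' s (t ++ d') := by
  induction g generalizing s with
  | nil => exact ⟨[], trivial, trivial, .nil, hmax s hs hsr h⟩
  | cons x g ih =>
    obtain ⟨e, u⟩ := x
    obtain ⟨hu, he, hlt, hne, hg⟩ := hg
    cases h with
    | skip hle h =>
      obtain ⟨t, ht, htr, htg, hst⟩ := ih hg hs hsr h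
      by_cases hred : headCell c t < M.minv u
      · refine ⟨t, ht, htr, .skip (hred.le.trans ?_) htg, hst⟩
        rcases he with he | he
        · exact (minv_covBy hu).le.trans he.ge
        · exact he.ge
      · exact ⟨(e, u) :: t, .cons_of_le hu he hlt hne htg.headCell_le ht, ⟨hred, htr⟩,
          .keep le_rfl htg, .skip hle hst⟩
    | keep hle h =>
      obtain ⟨t, ht, htr, htg, hst⟩ := ih hg hs.2.2.2.2 hsr.2 h
      exact ⟨_ :: t, .cons_of_le hu hs.2.1 hlt hne htg.headCell_le ht,
        ⟨fun hred => hsr.1 ((hst.headCell_le.trans (headCell_append_le hd')).trans_lt hred), htr⟩,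
        .keep hle htg, .keep le_rfl hst⟩

end Reduction

end FlowPath

/-- for composable flow paths, the reductions `r(γ)` and `r(δ)` are
composable and `r(γ * δ) = r(r(γ) * r(δ))`. -/
theorem stmt14 {P : Type} [PartialOrder P] [Fintype P]
    (rk : P → ℕ) (hrk : ∀ a b : P, a ⋖ b → rk b = rk a + 1)
    (M : PartialMatching P) (hM : M.IsAcyclic)
    (γ δ rγ rδ ρ : FlowPath P) (hγ : γ.Valid M) (hδ : δ.Valid M)
    (hcomp : δ.init < γ.tgt)
    (hrγ : FlowPath.IsReduction M γ rγ) (hrδ : FlowPath.IsReduction M δ rδ)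
    (hρ : FlowPath.IsReduction M (γ.concat δ) ρ) :
    rδ.init < rγ.tgt ∧
    ∀ ρ' : FlowPath P, FlowPath.IsReduction M (rγ.concat rδ) ρ' → ρ = ρ' := by
  obtain ⟨lγ, c⟩ := γ
  obtain ⟨lδ, b⟩ := δ
  obtain ⟨rγ, c'⟩ := rγ
  obtain ⟨rδ, b'⟩ := rδ
  obtain ⟨ρ, a⟩ := ρ
  have hmono := FlowPath.strictMono_of_covBy hrk
  simp only [FlowPath.init, FlowPath.tgt, FlowPath.eAt_zero] at hcomp ⊢
  obtain ⟨vγ, redγ, subγ, maxγ⟩ := hrγ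
  obtain ⟨vδ, redδ, subδ, maxδ⟩ := hrδ
  obtain ⟨vρ, redρ, subρ, maxρ⟩ := hρ
  have hδle := (FlowPath.subpath_iff.1 subδ).headCell_le
  rw [FlowPath.valid_iff] at hγ
  have vγ' := (FlowPath.valid_iff M _ _).1 vγ
  have vρ' := (FlowPath.valid_iff M _ _).1 vρ
  have hlt := hδle.trans_lt hcomp
  obtain ⟨t, ht, htr, htγ, hρt⟩ := FlowPath.exists_reduced_append hlt.le hγ.2
    (fun t ht htr hle => FlowPath.subpath_iff.1 (maxδ ⟨t, a⟩
      ((FlowPath.valid_iff M _ _).2 ⟨vρ'.1, ht⟩) ((FlowPath.reduced_iff M _ _).2 htr) hle.subpath))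
    vρ'.2 ((FlowPath.reduced_iff M _ _).1 redρ) (FlowPath.subpath_iff.1 subρ)
  have htrγ := FlowPath.subpath_iff.1 (maxγ ⟨t, c⟩ ((FlowPath.valid_iff M _ _).2 ⟨hγ.1, ht⟩)
    ((FlowPath.reduced_iff M _ _).2 htr) htγ.emb.subpath)
  have subγ' := FlowPath.subpath_iff.1 subγ
  obtain ⟨rfl, hfull⟩ := subγ'.full hmono hrk vγ'.2 hγ.1 (htrγ.rank_le hmono hrk ht)
  obtain ⟨-, htfull⟩ := htrγ.full hmono hrk ht hγ.1 le_rfl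
  refine ⟨hlt, fun ρ' ⟨vρ', redρ', subρ', maxρ'⟩ => ?_⟩
  obtain ⟨ρ', a'⟩ := ρ'
  refine FlowPath.Subpath.antisymm hmono hrk vρ vρ' (maxρ' _ vρ redρ ?_) (maxρ _ vρ' redρ' ?_)
  · exact (hρt.trans (htfull.append (.refl _ _) hlt.le)).subpath
  · exact ((FlowPath.subpath_iff.1 subρ').trans
      (hfull.append (FlowPath.subpath_iff.1 subδ) hlt.le)).subpath
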